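/- There exist sixteen pairwise inequivalent extremal Type II Z_8-codes of length 32; that is, there exist Z_8-codes C_1, …, C_16 of length 32, each self-dual with all Euclidean weights divisible by 16 and with minimum Euclidean weight 32 over nonzero codewords, such that no two of them are equivalent. -/

import Mathlib

open Finset

/-- Inner product of two vectors over `ZMod N`. -/
def innerZ {N n : ℕ} (x y : Fin n → ZMod N) : ZMod N := ∑ i, x i * y i

/-- Euclidean weight of a vector over `ZMod N`. -/
def euclWt {N n : ℕ} (x : Fin n → ZMod N) : ℕ :=
  ∑ i, min ((x i).val ^ 2) ((N - (x i).val) ^ 2)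

/-- Number of coordinates of `x` equal to `a`. -/
def cntEq {N n : ℕ} (a : ZMod N) (x : Fin n → ZMod N) : ℕ :=
  (Finset.univ.filter fun j => x j = a).card

/-- A code is self-dual if it equals its dual. -/
def IsSelfDual {N n : ℕ} (C : AddSubgroup (Fin n → ZMod N)) : Prop :=
  ∀ x, x ∈ C ↔ ∀ y ∈ C, innerZ x y = 0

/-- The subcode `{v ∈ C : ⟨w, v⟩ = 0}`. -/
def evenPart {N n : ℕ} (C : AddSubgroup (Fin n → ZMod N)) (w : Fin n → ZMod N) :
    AddSubgroup (Fin n → ZMod N) where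
  carrier := {v | v ∈ C ∧ innerZ w v = 0}
  zero_mem' := ⟨C.zero_mem, by simp [innerZ]⟩
  add_mem' := by
    rintro a b ⟨ha, ha0⟩ ⟨hb, hb0⟩
    refine ⟨C.add_mem ha hb, ?_⟩
    have h : innerZ w (a + b) = innerZ w a + innerZ w b := by
      simp [innerZ, mul_add, Finset.sum_add_distrib]
    rw [h, ha0, hb0, add_zero]
  neg_mem' := by
    rintro a ⟨ha, ha0⟩
    refine ⟨C.neg_mem ha, ?_⟩
    have h : innerZ w (-a) = - innerZ w a := by
      simp [innerZ]
    rw [h, ha0, neg_zero]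

/-- `kv` extended to all of `ℕ` by zero. -/
def extk {m : ℕ} (kv : Fin m → ℕ) : ℕ → ℕ := fun t => if h : t < m then kv ⟨t, h⟩ else 0

/-- Partial sums `k_1 + ⋯ + k_j`. -/
def psum {m : ℕ} (kv : Fin m → ℕ) (j : ℕ) : ℕ := ∑ t ∈ Finset.range j, extk kv t

/-- `G` is a generator matrix in standard form of type `(k_1, …, k_m)`. -/
def StandardForm {N : ℕ} {m n : ℕ} (kv : Fin m → ℕ)
    (G : Fin (psum kv m) → Fin n → ZMod N) : Prop :=
  psum kv m ≤ n ∧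
  ∀ (j : Fin m) (r : Fin (psum kv m)), psum kv (j : ℕ) ≤ (r : ℕ) → (r : ℕ) < psum kv ((j : ℕ) + 1) →
    ∀ c : Fin n,
      (∀ l : Fin m, psum kv (l : ℕ) ≤ (c : ℕ) → (c : ℕ) < psum kv ((l : ℕ) + 1) →
        (l < j → G r c = 0) ∧
        (l = j → G r c = if (r : ℕ) = (c : ℕ) then (2 ^ (j : ℕ) : ZMod N) else 0)) ∧
      ((psum kv m ≤ (c : ℕ) ∨
        ∃ l : Fin m, j < l ∧ psum kv (l : ℕ) ≤ (c : ℕ) ∧ (c : ℕ) < psum kv ((l : ℕ) + 1)) →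
        ∃ a : ZMod N, G r c = 2 ^ (j : ℕ) * a)

/-- The minimum Euclidean weight over nonzero codewords equals `d`. -/
def minEuclWtIs {N n : ℕ} (C : AddSubgroup (Fin n → ZMod N)) (d : ℕ) : Prop :=
  (∀ x ∈ C, x ≠ 0 → d ≤ euclWt x) ∧ ∃ x ∈ C, x ≠ 0 ∧ euclWt x = d

/-- Coordinatewise reduction modulo 4. -/
def res4 {n : ℕ} : (Fin n → ZMod 8) →+ (Fin n → ZMod 4) where
  toFun := fun x i => ZMod.castHom (by norm_num : (4 : ℕ) ∣ 8) (ZMod 4) (x i)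
  map_zero' := by ext i; simp
  map_add' := by intro a b; ext i; exact map_add (ZMod.castHom (by norm_num) _) _ _

/-- Coordinatewise reduction modulo 2. -/
def res2 {n : ℕ} : (Fin n → ZMod 8) →+ (Fin n → ZMod 2) where
  toFun := fun x i => ZMod.castHom (by norm_num : (2 : ℕ) ∣ 8) (ZMod 2) (x i)
  map_zero' := by ext i; simp
  map_add' := by intro a b; ext i; exact map_add (ZMod.castHom (by norm_num) _) _ _

/-- Hamming weight of a binary vector. -/
def hammingWt {n : ℕ} (y : Fin n → ZMod 2) : ℕ :=
  (Finset.univ.filter fun i => y i ≠ 0).card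

/-- Equivalence of codes: a permutation of coordinates combined with sign changes. -/
def codeEquiv {N n : ℕ} (C C' : AddSubgroup (Fin n → ZMod N)) : Prop :=
  ∃ (σ : Equiv.Perm (Fin n)) (ε : Fin n → ZMod N),
    (∀ i, ε i = 1 ∨ ε i = -1) ∧
    ∀ y, y ∈ C' ↔ ∃ x ∈ C, y = fun i => ε i * x (σ i)


/-! ### Neighbours of self-dual codes -/

section Neighbour

variable {n : ℕ}

lemma innerZ_comm {N : ℕ} (x y : Fin n → ZMod N) : innerZ x y = innerZ y x :=
  dotProduct_comm x y

lemma innerZ_add_left {N : ℕ} (x y z : Fin n → ZMod N) :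
    innerZ (x + y) z = innerZ x z + innerZ y z :=
  add_dotProduct x y z

lemma innerZ_add_right {N : ℕ} (x y z : Fin n → ZMod N) :
    innerZ x (y + z) = innerZ x y + innerZ x z :=
  dotProduct_add x y z

lemma innerZ_sub_left {N : ℕ} (x y z : Fin n → ZMod N) :
    innerZ (x - y) z = innerZ x z - innerZ y z :=
  sub_dotProduct x y z

lemma innerZ_zsmul_left {N : ℕ} (k : ℤ) (x y : Fin n → ZMod N) :
    innerZ (k • x) y = k • innerZ x y :=
  smul_dotProduct k x y

lemma innerZ_zsmul_right {N : ℕ} (k : ℤ) (x y : Fin n → ZMod N) :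
    innerZ x (k • y) = k • innerZ x y :=
  dotProduct_smul k x y

/-- The neighbour of the code `C` obtained by adjoining `u` to `{v ∈ C : ⟨u, v⟩ = 0}`. -/
def neighbour {N : ℕ} (C : AddSubgroup (Fin n → ZMod N)) (u : Fin n → ZMod N) :
    AddSubgroup (Fin n → ZMod N) :=
  evenPart C u ⊔ AddSubgroup.zmultiples u

lemma mem_neighbour {N : ℕ} {C : AddSubgroup (Fin n → ZMod N)} {u x : Fin n → ZMod N} :
    x ∈ neighbour C u ↔ ∃ v ∈ C, innerZ u v = 0 ∧ ∃ k : ℤ, v + k • u = x := by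
  simp only [neighbour, AddSubgroup.mem_sup, AddSubgroup.mem_zmultiples_iff]
  constructor
  · rintro ⟨v, ⟨hv, huv⟩, _, ⟨k, rfl⟩, rfl⟩
    exact ⟨v, hv, huv, k, rfl⟩
  · rintro ⟨v, hv, huv, k, rfl⟩
    exact ⟨v, ⟨hv, huv⟩, _, ⟨k, rfl⟩, rfl⟩

lemma self_mem_neighbour {N : ℕ} (C : AddSubgroup (Fin n → ZMod N)) (u : Fin n → ZMod N) :
    u ∈ neighbour C u :=
  AddSubgroup.mem_sup_right (AddSubgroup.mem_zmultiples u)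

lemma mem_neighbour_of_mem {N : ℕ} {C : AddSubgroup (Fin n → ZMod N)} {u v : Fin n → ZMod N}
    (hv : v ∈ C) (h : innerZ u v = 0) : v ∈ neighbour C u :=
  AddSubgroup.mem_sup_left ⟨hv, h⟩

lemma exists_eq_zsmul_of_annihilator (a b : ZMod 8) (h : ∀ k : ZMod 8, k * a = 0 → k * b = 0) :
    ∃ k : ZMod 8, b = k * a := by
  revert a b; decide

/-- A functional on `C` vanishing on the kernel of `⟨u, ·⟩` is a multiple of `⟨u, ·⟩`. -/
lemma exists_innerZ_eq_zsmul {C : AddSubgroup (Fin n → ZMod 8)} {u x : Fin n → ZMod 8}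
    (h : ∀ v ∈ C, innerZ u v = 0 → innerZ x v = 0) :
    ∃ k : ℤ, ∀ v ∈ C, innerZ x v = k • innerZ u v := by
  let f : (Fin n → ZMod 8) →+ ZMod 8 := AddMonoidHom.mk' (innerZ u) (innerZ_add_right u)
  obtain ⟨⟨g, hg⟩, hgen⟩ := IsAddCyclic.exists_generator (α := C.map f)
  obtain ⟨v₀, hv₀, rfl⟩ := hg
  have key : ∀ v ∈ C, ∃ m : ℤ, innerZ u v = m • innerZ u v₀ ∧ innerZ x v = m • innerZ x v₀ := by
    intro v hv
    obtain ⟨m, hm⟩ := AddSubgroup.mem_zmultiples_iff.1 (hgen ⟨f v, v, hv, rfl⟩)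
    have hm' : m • innerZ u v₀ = innerZ u v := congrArg Subtype.val hm
    have h0 := h (v + (-m) • v₀) (C.add_mem hv (C.zsmul_mem hv₀ _)) (by
      rw [innerZ_add_right, innerZ_zsmul_right, ← hm']; simp)
    rw [innerZ_add_right, innerZ_zsmul_right, neg_smul, add_neg_eq_zero] at h0
    exact ⟨m, hm'.symm, h0⟩
  obtain ⟨k, hk⟩ := exists_eq_zsmul_of_annihilator (innerZ u v₀) (innerZ x v₀) (by
    intro k hk
    have e : ∀ y : Fin n → ZMod 8, innerZ y ((k.val : ℤ) • v₀) = k * innerZ y v₀ := by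
      intro y; rw [innerZ_zsmul_right, zsmul_eq_mul]; simp
    rw [← e]
    exact h _ (C.zsmul_mem hv₀ _) (by rw [e, hk]))
  refine ⟨k.val, fun v hv => ?_⟩
  obtain ⟨m, hm, hm'⟩ := key v hv
  rw [hm', hm, hk]
  simp only [zsmul_eq_mul]
  push_cast
  rw [ZMod.natCast_val, ZMod.cast_id]
  ring

lemma IsSelfDual.neighbour {C : AddSubgroup (Fin n → ZMod 8)} (hC : IsSelfDual C)
    {u : Fin n → ZMod 8} (hu : innerZ u u = 0) : IsSelfDual (neighbour C u) := by
  intro x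
  constructor
  · intro hx y hy
    obtain ⟨v, hv, huv, k, rfl⟩ := mem_neighbour.1 hx
    obtain ⟨w, hw, huw, l, rfl⟩ := mem_neighbour.1 hy
    simp only [innerZ_add_left, innerZ_add_right, innerZ_zsmul_left, innerZ_zsmul_right, hu, huw,
      innerZ_comm v u, huv, (hC v).1 hv w hw, smul_zero, add_zero]
  · intro hx
    obtain ⟨k, hk⟩ := exists_innerZ_eq_zsmul (C := C) (u := u) (x := x)
      fun v hv huv => hx v (mem_neighbour_of_mem hv huv)
    refine mem_neighbour.2 ⟨x - k • u, (hC _).2 fun v hv => ?_, ?_, k, sub_add_cancel _ _⟩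
    · rw [innerZ_sub_left, innerZ_zsmul_left, hk v hv, sub_self]
    · rw [innerZ_comm, innerZ_sub_left, innerZ_zsmul_left, hu, hx u (self_mem_neighbour C u)]
      simp

end Neighbour

/-! ### Euclidean weights modulo 16 -/

section Weight

variable {n : ℕ}

/-- Euclidean weight of an element of `ZMod 8`. -/
def sqWt (a : ZMod 8) : ℕ := min (a.val ^ 2) ((8 - a.val) ^ 2)

lemma euclWt_eq_sum (x : Fin n → ZMod 8) : euclWt x = ∑ i, sqWt (x i) := rfl

/-- Multiplication by two, from `ZMod 8` to `ZMod 16`. -/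
def twice : ZMod 8 →+ ZMod 16 where
  toFun a := ((2 * a.val : ℕ) : ZMod 16)
  map_zero' := by decide
  map_add' := by decide

lemma sqWt_add (a b : ZMod 8) :
    (sqWt (a + b) : ZMod 16) = sqWt a + sqWt b + twice (a * b) := by
  revert a b; decide

lemma euclWt_add (x y : Fin n → ZMod 8) :
    (euclWt (x + y) : ZMod 16) = euclWt x + euclWt y + twice (innerZ x y) := by
  simp only [euclWt_eq_sum, innerZ, Nat.cast_sum, map_sum, ← Finset.sum_add_distrib, Pi.add_apply,
    sqWt_add]

lemma dvd_euclWt_add {x y : Fin n → ZMod 8} (hx : 16 ∣ euclWt x) (hy : 16 ∣ euclWt y)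
    (h : innerZ x y = 0) : 16 ∣ euclWt (x + y) := by
  rw [← ZMod.natCast_eq_zero_iff] at *
  rw [euclWt_add, hx, hy, h, map_zero]; rfl

lemma euclWt_neg (x : Fin n → ZMod 8) : euclWt (-x) = euclWt x :=
  Finset.sum_congr rfl fun i _ => (by decide : ∀ a : ZMod 8, sqWt (-a) = sqWt a) (x i)

/-- The codewords of Euclidean weight divisible by 16 in a self-dual code. -/
def doublyEvenPart (C : AddSubgroup (Fin n → ZMod 8)) (hC : IsSelfDual C) :
    AddSubgroup (Fin n → ZMod 8) where
  carrier := {x | x ∈ C ∧ 16 ∣ euclWt x}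
  zero_mem' := ⟨C.zero_mem, by simp [euclWt]⟩
  add_mem' := fun {x y} hx hy => ⟨C.add_mem hx.1 hy.1,
    dvd_euclWt_add hx.2 hy.2 ((hC x).1 hx.1 y hy.1)⟩
  neg_mem' := fun {x} hx => ⟨C.neg_mem hx.1, by rw [euclWt_neg]; exact hx.2⟩

lemma dvd_euclWt_neighbour {C : AddSubgroup (Fin n → ZMod 8)} (hC : IsSelfDual C)
    (hC16 : ∀ x ∈ C, 16 ∣ euclWt x) {u : Fin n → ZMod 8} (hu : innerZ u u = 0)
    (hu16 : 16 ∣ euclWt u) {x : Fin n → ZMod 8} (hx : x ∈ neighbour C u) : 16 ∣ euclWt x := by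
  have h : neighbour C u ≤ doublyEvenPart _ (hC.neighbour hu) :=
    sup_le (fun v hv => ⟨mem_neighbour_of_mem hv.1 hv.2, hC16 v hv.1⟩)
      (AddSubgroup.zmultiples_le_of_mem ⟨self_mem_neighbour C u, hu16⟩)
  exact (h hx).2

end Weight

/-! ### Construction of a code over `ZMod 8` from a binary code -/

section Base

variable {n : ℕ}

/-- The code of all `2 • y` with `y` reducing modulo 2 to a word of the binary code `B`. -/
def twiceCode (B : AddSubgroup (Fin n → ZMod 2)) : AddSubgroup (Fin n → ZMod 8) :=
  (B.comap res2).map (zsmulAddGroupHom 2)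

lemma mem_twiceCode {B : AddSubgroup (Fin n → ZMod 2)} {x : Fin n → ZMod 8} :
    x ∈ twiceCode B ↔ ∃ y, res2 y ∈ B ∧ (2 : ℤ) • y = x := by
  simp [twiceCode, zsmulAddGroupHom]

lemma two_zsmul_mem_twiceCode {B : AddSubgroup (Fin n → ZMod 2)} {y : Fin n → ZMod 8}
    (hy : res2 y ∈ B) : (2 : ℤ) • y ∈ twiceCode B :=
  mem_twiceCode.2 ⟨y, hy, rfl⟩

lemma res2_apply (x : Fin n → ZMod 8) (i : Fin n) :
    res2 x i = ZMod.castHom (by norm_num : (2 : ℕ) ∣ 8) (ZMod 2) (x i) := rfl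

lemma castHom_two_eq_zero_iff (a : ZMod 8) :
    ZMod.castHom (by norm_num : (2 : ℕ) ∣ 8) (ZMod 2) a = 0 ↔ 4 * a = 0 := by
  revert a; decide

lemma innerZ_res2 (x y : Fin n → ZMod 8) :
    innerZ (res2 x) (res2 y) =
      ZMod.castHom (by norm_num : (2 : ℕ) ∣ 8) (ZMod 2) (innerZ x y) := by
  simp only [innerZ, map_sum, map_mul, res2_apply]

lemma res2_surjective : Function.Surjective (res2 (n := n)) := by
  intro b
  refine ⟨fun i => (b i).val, funext fun i => ?_⟩
  rw [res2_apply]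
  exact (by decide : ∀ a : ZMod 2,
    ZMod.castHom (Dvd.intro 4 rfl : (2 : ℕ) ∣ 8) (ZMod 2) (a.val : ZMod 8) = a) (b i)

lemma res2_eq_zero_of_mem_twiceCode {B : AddSubgroup (Fin n → ZMod 2)} {x : Fin n → ZMod 8}
    (hx : x ∈ twiceCode B) : res2 x = 0 := by
  obtain ⟨y, -, rfl⟩ := mem_twiceCode.1 hx
  rw [map_zsmul]
  ext i
  exact (by decide : ∀ a : ZMod 2, (2 : ℤ) • a = 0) _

lemma exists_eq_two_zsmul {x : Fin n → ZMod 8} (h : res2 x = 0) :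
    ∃ y : Fin n → ZMod 8, (2 : ℤ) • y = x := by
  have h' : ∀ i, ∃ a : ZMod 8, (2 : ℤ) • a = x i := fun i =>
    (by decide : ∀ b : ZMod 8, 4 * b = 0 → ∃ a : ZMod 8, (2 : ℤ) • a = b) _
      ((castHom_two_eq_zero_iff _).1 (congrFun h i))
  choose y hy using h'
  exact ⟨y, funext hy⟩

lemma innerZ_single_right {N : ℕ} (x : Fin n → ZMod N) (i : Fin n) (a : ZMod N) :
    innerZ x (Pi.single i a) = x i * a :=
  dotProduct_single x a i

lemma IsSelfDual.twiceCode {B : AddSubgroup (Fin n → ZMod 2)} (hB : IsSelfDual B) :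
    IsSelfDual (twiceCode B) := by
  have h4 : ∀ y z : Fin n → ZMod 8, innerZ ((2 : ℤ) • y) ((2 : ℤ) • z) = 0 ↔
      innerZ (res2 y) (res2 z) = 0 := by
    intro y z
    rw [innerZ_res2, castHom_two_eq_zero_iff, innerZ_zsmul_left, innerZ_zsmul_right, smul_smul,
      zsmul_eq_mul]
    norm_num
  intro x
  constructor
  · intro hx y hy
    obtain ⟨a, ha, rfl⟩ := mem_twiceCode.1 hx
    obtain ⟨b, hb, rfl⟩ := mem_twiceCode.1 hy
    exact (h4 a b).2 ((hB _).1 ha _ hb)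
  · intro hx
    obtain ⟨y, rfl⟩ : ∃ y : Fin n → ZMod 8, (2 : ℤ) • y = x := by
      refine exists_eq_two_zsmul (funext fun i => (castHom_two_eq_zero_iff _).2 ?_)
      have := hx ((2 : ℤ) • ((2 : ℤ) • Pi.single i 1)) (two_zsmul_mem_twiceCode (by
        rw [res2_eq_zero_of_mem_twiceCode (B := ⊤)
          (two_zsmul_mem_twiceCode (AddSubgroup.mem_top _))]
        exact B.zero_mem))
      rw [innerZ_zsmul_right, innerZ_zsmul_right, innerZ_single_right, smul_smul, mul_one,
        zsmul_eq_mul] at this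
      exact_mod_cast this
    refine two_zsmul_mem_twiceCode ((hB _).2 fun b hb => ?_)
    obtain ⟨z, rfl⟩ := res2_surjective b
    exact (h4 y z).1 (hx _ (two_zsmul_mem_twiceCode hb))

lemma sqWt_two_zsmul (a : ZMod 8) : (sqWt ((2 : ℤ) • a) : ZMod 16) =
    if ZMod.castHom (by norm_num : (2 : ℕ) ∣ 8) (ZMod 2) a = 0 then 0 else 4 := by
  revert a; decide

lemma euclWt_two_zsmul (y : Fin n → ZMod 8) :
    (euclWt ((2 : ℤ) • y) : ZMod 16) = (4 * hammingWt (res2 y) : ℕ) := by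
  rw [euclWt_eq_sum, Nat.cast_sum, hammingWt, Finset.card_filter, Finset.mul_sum, Nat.cast_sum]
  refine Finset.sum_congr rfl fun i _ => ?_
  rw [Pi.smul_apply, sqWt_two_zsmul, res2_apply]
  split_ifs <;> simp_all

lemma dvd_euclWt_two_zsmul_iff (y : Fin n → ZMod 8) :
    16 ∣ euclWt ((2 : ℤ) • y) ↔ 4 ∣ hammingWt (res2 y) := by
  rw [← ZMod.natCast_eq_zero_iff, euclWt_two_zsmul, ZMod.natCast_eq_zero_iff]
  omega

lemma four_mul_hammingWt_le (y : Fin n → ZMod 8) :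
    4 * hammingWt (res2 y) ≤ euclWt ((2 : ℤ) • y) := by
  rw [hammingWt, Finset.card_filter, Finset.mul_sum, euclWt_eq_sum]
  refine Finset.sum_le_sum fun i _ => ?_
  exact (by decide : ∀ a : ZMod 8,
    4 * (if ZMod.castHom (Dvd.intro 4 rfl : (2 : ℕ) ∣ 8) (ZMod 2) a ≠ 0 then 1 else 0) ≤
      sqWt ((2 : ℤ) • a)) (y i)

end Base

/-! ### Equivalence and residue codes -/

section Residue

variable {n : ℕ}

/-- Number of words of Hamming weight `w` in the residue code of `C`. -/
noncomputable def residueCount (C : AddSubgroup (Fin n → ZMod 8)) (w : ℕ) : ℕ :=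
  Set.ncard {c | c ∈ C.map res2 ∧ hammingWt c = w}

lemma hammingWt_comp_perm (c : Fin n → ZMod 2) (σ : Equiv.Perm (Fin n)) :
    hammingWt (c ∘ σ) = hammingWt c := by
  simp only [hammingWt, Finset.card_filter, Function.comp]
  exact Equiv.sum_comp σ fun i => if c i ≠ 0 then 1 else 0

lemma residueCount_eq_of_codeEquiv {C C' : AddSubgroup (Fin n → ZMod 8)} (h : codeEquiv C C')
    (w : ℕ) : residueCount C w = residueCount C' w := by
  obtain ⟨σ, ε, hε, h⟩ := h
  have hres : ∀ x : Fin n → ZMod 8, res2 (fun i => ε i * x (σ i)) = res2 x ∘ σ := by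
    intro x
    ext1 i
    simp only [res2_apply, Function.comp, map_mul]
    rcases hε i with h | h <;> rw [h]
    · rw [map_one, one_mul]
    · rw [map_neg, map_one]
      exact (by decide : ∀ a : ZMod 2, -1 * a = a) _
  have himg : {c | c ∈ C'.map res2 ∧ hammingWt c = w} =
      (fun c => c ∘ σ) '' {c | c ∈ C.map res2 ∧ hammingWt c = w} := by
    ext c
    simp only [AddSubgroup.mem_map, Set.mem_ofPred_eq, Set.mem_image]
    constructor
    · rintro ⟨⟨y, hy, rfl⟩, hw⟩
      obtain ⟨x, hx, rfl⟩ := (h y).1 hy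
      rw [hres] at hw ⊢
      exact ⟨_, ⟨⟨x, hx, rfl⟩, by rwa [hammingWt_comp_perm] at hw⟩, rfl⟩
    · rintro ⟨_, ⟨⟨x, hx, rfl⟩, hw⟩, rfl⟩
      exact ⟨⟨_, (h _).2 ⟨x, hx, rfl⟩, hres x⟩, by rwa [hammingWt_comp_perm]⟩
  rw [residueCount, residueCount, himg,
    Set.ncard_image_of_injective _ σ.surjective.injective_comp_right]

end Residue

/-! ### Iterated neighbours -/

section Chain

variable {n : ℕ} {B : AddSubgroup (Fin n → ZMod 2)}

/-- Iterated neighbours of `twiceCode B` with respect to the words of a list. -/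
def chainCode (B : AddSubgroup (Fin n → ZMod 2)) :
    List (Fin n → ZMod 8) → AddSubgroup (Fin n → ZMod 8)
  | [] => twiceCode B
  | u :: L => neighbour (chainCode B L) u

lemma isSelfDual_chainCode (hB : IsSelfDual B) {L : List (Fin n → ZMod 8)}
    (hL : ∀ u ∈ L, innerZ u u = 0) : IsSelfDual (chainCode B L) := by
  induction L with
  | nil => exact hB.twiceCode
  | cons u L ih =>
    rw [List.forall_mem_cons] at hL
    exact (ih hL.2).neighbour hL.1

lemma dvd_euclWt_chainCode (hB : IsSelfDual B) (hB4 : ∀ b ∈ B, 4 ∣ hammingWt b)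
    {L : List (Fin n → ZMod 8)} (hL : ∀ u ∈ L, innerZ u u = 0) (hL16 : ∀ u ∈ L, 16 ∣ euclWt u) :
    ∀ x ∈ chainCode B L, 16 ∣ euclWt x := by
  induction L with
  | nil =>
    intro x hx
    obtain ⟨y, hy, rfl⟩ := mem_twiceCode.1 hx
    exact (dvd_euclWt_two_zsmul_iff y).2 (hB4 _ hy)
  | cons u L ih =>
    rw [List.forall_mem_cons] at hL hL16
    exact fun x => dvd_euclWt_neighbour (isSelfDual_chainCode hB hL.2) (ih hL.2 hL16.2) hL.1 hL16.1

lemma exists_sublist_of_mem_chainCode {L : List (Fin n → ZMod 8)} (hL : ∀ u ∈ L, res2 u ∈ B)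
    {x : Fin n → ZMod 8} (hx : x ∈ chainCode B L) :
    ∃ l : List (Fin n → ZMod 8), l.Sublist L ∧ x - l.sum ∈ twiceCode B := by
  induction L generalizing x with
  | nil => exact ⟨[], List.Sublist.slnil, by simpa [chainCode] using hx⟩
  | cons u L ih =>
    rw [List.forall_mem_cons] at hL
    obtain ⟨v, hv, -, k, rfl⟩ := mem_neighbour.1 hx
    obtain ⟨l, hl, hvl⟩ := ih hL.2 hv
    have hu := two_zsmul_mem_twiceCode hL.1
    obtain ⟨m, rfl | rfl⟩ := Int.even_or_odd' k
    · refine ⟨l, hl.cons u, ?_⟩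
      have := (twiceCode B).add_mem hvl ((twiceCode B).zsmul_mem hu m)
      rwa [smul_smul, mul_comm, sub_add_eq_add_sub] at this
    · refine ⟨u :: l, hl.cons_cons u, ?_⟩
      have := (twiceCode B).add_mem hvl ((twiceCode B).zsmul_mem hu m)
      rw [List.sum_cons]
      convert this using 1
      rw [add_smul, mul_smul, one_smul, smul_comm]
      abel

lemma mem_chainCode_of_mem {L : List (Fin n → ZMod 8)}
    (hL : L.Pairwise fun u v => innerZ u v = 0) {u : Fin n → ZMod 8} (hu : u ∈ L) :
    u ∈ chainCode B L := by
  induction L with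
  | nil => simp at hu
  | cons w L ih =>
    rw [List.pairwise_cons] at hL
    rcases List.mem_cons.1 hu with rfl | hu
    · exact self_mem_neighbour _ _
    · exact mem_neighbour_of_mem (ih hL.2 hu) (hL.1 u hu)

lemma mem_map_res2_chainCode {L : List (Fin n → ZMod 8)}
    (hL : L.Pairwise fun u v => innerZ u v = 0) (hLB : ∀ u ∈ L, res2 u ∈ B) {c : Fin n → ZMod 2} :
    c ∈ (chainCode B L).map res2 ↔ c ∈ L.sublists.map fun l => res2 l.sum := by
  simp only [AddSubgroup.mem_map, List.mem_map, List.mem_sublists]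
  constructor
  · rintro ⟨x, hx, rfl⟩
    obtain ⟨l, hl, hxl⟩ := exists_sublist_of_mem_chainCode hLB hx
    refine ⟨l, hl, ?_⟩
    have := res2_eq_zero_of_mem_twiceCode hxl
    rw [map_sub, sub_eq_zero] at this
    exact this.symm
  · rintro ⟨l, hl, rfl⟩
    exact ⟨l.sum, AddSubgroup.list_sum_mem _ fun u hu =>
      mem_chainCode_of_mem hL (hl.subset hu), rfl⟩

lemma residueCount_chainCode {L : List (Fin n → ZMod 8)}
    (hL : L.Pairwise fun u v => innerZ u v = 0) (hLB : ∀ u ∈ L, res2 u ∈ B) (w : ℕ) :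
    residueCount (chainCode B L) w =
      (((L.sublists.map fun l => res2 l.sum).toFinset).filter fun c => hammingWt c = w).card := by
  rw [residueCount, ← Set.ncard_coe_finset]
  congr 1
  ext c
  simp only [Set.mem_ofPred_eq, mem_map_res2_chainCode hL hLB, Finset.coe_filter,
    List.mem_toFinset]

end Chain

/-! ### The Reed–Muller code of order 2 and length 32 -/

section ReedMuller

/-- The vector of length 32 over `ZMod N` whose entries are the binary digits of `m`. -/
def bitVec (N m : ℕ) : Fin 32 → ZMod N := fun i => if m.testBit i then 1 else 0

/-- The monomial function on `𝔽₂⁵` given by the product of the variables in the binary support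
of `t`; points of `𝔽₂⁵` are written as binary numbers. -/
def monomialWord (t i : Fin 32) : ZMod 2 := if t.val &&& i.val = t.val then 1 else 0

/-- Number of binary digits equal to one. -/
def bitDegree (t : Fin 32) : ℕ := (univ.filter fun m : Fin 5 => t.val.testBit m).card

/-- The Reed–Muller code of order 2 and length 32, by its parity checks. -/
def reedMuller : AddSubgroup (Fin 32 → ZMod 2) where
  carrier := {x | ∀ t, bitDegree t ≤ 2 → innerZ (monomialWord t) x = 0}
  zero_mem' := fun t _ => by simp [innerZ]
  add_mem' := fun {x y} hx hy t ht => by rw [innerZ_add_right, hx t ht, hy t ht, add_zero]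
  neg_mem' := fun {x} hx t ht => by
    rw [← neg_one_zsmul, innerZ_zsmul_right, hx t ht, smul_zero]

lemma sum_monomialWord_mul_monomialWord :
    ∀ i j, ∑ s, monomialWord s i * monomialWord j s = if i = j then 1 else 0 := by
  decide +kernel

lemma monomialWord_swap :
    ∀ s j, monomialWord j s = ∑ t, if s.val &&& t.val = 0 then monomialWord t j else 0 := by
  decide +kernel

lemma bitDegree_le_or_le :
    ∀ s t : Fin 32, s.val &&& t.val = 0 → bitDegree s ≤ 2 ∨ bitDegree t ≤ 2 := by
  decide +kernel

lemma monomialWord_mem_reedMuller : ∀ t, bitDegree t ≤ 2 → monomialWord t ∈ reedMuller := by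
  have : ∀ t s, bitDegree t ≤ 2 → bitDegree s ≤ 2 →
      innerZ (monomialWord s) (monomialWord t) = 0 := by
    decide +kernel
  exact fun t ht s hs => this t s ht hs

lemma sum_monomialWord_of_mem {x : Fin 32 → ZMod 2} (hx : x ∈ reedMuller) {s : Fin 32}
    (hs : ¬ bitDegree s ≤ 2) : ∑ j, monomialWord j s * x j = 0 := by
  have h : ∀ t, (if s.val &&& t.val = 0 then innerZ (monomialWord t) x else 0) = 0 := by
    intro t
    split_ifs with hst
    · exact hx t ((bitDegree_le_or_le s t hst).resolve_left hs)
    · rfl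
  rw [← Finset.sum_eq_zero fun t _ => h t]
  simp only [monomialWord_swap s, Finset.sum_mul, innerZ, ite_mul, zero_mul]
  rw [Finset.sum_comm]
  refine Finset.sum_congr rfl fun t _ => ?_
  split_ifs <;> simp

lemma eq_sum_monomialWord (x : Fin 32 → ZMod 2) :
    x = ∑ s, (∑ j, monomialWord j s * x j) • monomialWord s := by
  ext i
  simp only [Finset.sum_apply, Pi.smul_apply, smul_eq_mul, Finset.sum_mul]
  rw [Finset.sum_comm]
  have h : ∀ j, ∑ s, monomialWord j s * x j * monomialWord s i = if i = j then x j else 0 := by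
    intro j
    rw [← mul_one (x j), ← mul_zero (x j), ← mul_ite, ← sum_monomialWord_mul_monomialWord,
      mul_one, Finset.mul_sum]
    exact Finset.sum_congr rfl fun s _ => by ring
  simp [h]

lemma isSelfDual_reedMuller : IsSelfDual reedMuller := by
  refine fun x => ⟨fun hx y hy => ?_, fun hx t ht => ?_⟩
  · have h : innerZ x y = ∑ s, (∑ j, monomialWord j s * x j) * innerZ (monomialWord s) y := by
      conv_lhs => rw [eq_sum_monomialWord x]
      simp only [innerZ, Finset.sum_apply, Pi.smul_apply, smul_eq_mul, Finset.mul_sum,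
        Finset.sum_mul (s := univ) (f := fun s => _ * monomialWord s _)]
      rw [Finset.sum_comm]
      simp only [mul_assoc]
    rw [h]
    refine Finset.sum_eq_zero fun s _ => ?_
    by_cases hs : bitDegree s ≤ 2
    · rw [hy s hs, mul_zero]
    · rw [sum_monomialWord_of_mem hx hs, zero_mul]
  · rw [innerZ_comm]
    exact hx _ (monomialWord_mem_reedMuller t ht)

lemma hammingWt_add {n : ℕ} (x y : Fin n → ZMod 2) :
    hammingWt (x + y) + 2 * (univ.filter fun i => x i * y i ≠ 0).card =
      hammingWt x + hammingWt y := by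
  simp only [hammingWt, Finset.card_filter, Finset.mul_sum, ← Finset.sum_add_distrib]
  refine Finset.sum_congr rfl fun i _ => ?_
  exact (by decide : ∀ a b : ZMod 2, (if a + b ≠ 0 then 1 else 0) + 2 * (if a * b ≠ 0 then 1 else 0)
    = (if a ≠ 0 then 1 else 0) + (if b ≠ 0 then 1 else 0)) (x i) (y i)

lemma sum_eq_card_ne_zero {ι : Type*} (s : Finset ι) (f : ι → ZMod 2) :
    ∑ i ∈ s, f i = ((s.filter fun i => f i ≠ 0).card : ZMod 2) := by
  rw [Finset.card_filter, Nat.cast_sum]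
  refine Finset.sum_congr rfl fun i _ => ?_
  exact (by decide : ∀ a : ZMod 2, a = ((if a ≠ 0 then 1 else 0 : ℕ) : ZMod 2)) (f i)

/-- The words of weight divisible by 4 in the Reed–Muller code. -/
def reedMullerDoublyEven : AddSubgroup (Fin 32 → ZMod 2) where
  carrier := {x | x ∈ reedMuller ∧ 4 ∣ hammingWt x}
  zero_mem' := ⟨zero_mem _, by simp [hammingWt]⟩
  add_mem' := fun {x y} hx hy => ⟨add_mem hx.1 hy.1, by
    have h := (isSelfDual_reedMuller x).1 hx.1 y hy.1
    rw [innerZ, sum_eq_card_ne_zero, ZMod.natCast_eq_zero_iff] at h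
    have := hammingWt_add x y
    have := hx.2
    have := hy.2
    omega⟩
  neg_mem' := fun {x} hx => ⟨neg_mem hx.1, by simpa [hammingWt] using hx.2⟩

lemma four_dvd_hammingWt_of_mem_reedMuller {x : Fin 32 → ZMod 2} (hx : x ∈ reedMuller) :
    4 ∣ hammingWt x := by
  have hm : ∀ t, bitDegree t ≤ 2 → 4 ∣ hammingWt (monomialWord t) := by decide +kernel
  suffices h : x ∈ reedMullerDoublyEven from h.2
  rw [eq_sum_monomialWord x]
  refine sum_mem fun s _ => ?_
  by_cases hs : bitDegree s ≤ 2
  · rcases (by decide : ∀ a : ZMod 2, a = 0 ∨ a = 1) (∑ j, monomialWord j s * x j) with h | h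
    · rw [h, zero_smul]
      exact zero_mem _
    · rw [h, one_smul]
      exact ⟨monomialWord_mem_reedMuller s hs, hm s hs⟩
  · rw [sum_monomialWord_of_mem hx hs, zero_smul]
    exact zero_mem _

/-- The set `S` of points of `𝔽₂⁵` meets every intersection of at most `r` coordinate
hyperplanes `x_m = 1` in an even number of points. -/
def EvenOnFlats : ℕ → Finset (Fin 32) → Prop
  | 0, S => Even S.card
  | r + 1, S => Even S.card ∧ ∀ m : Fin 5, EvenOnFlats r (S.filter fun i => i.val.testBit m)

lemma EvenOnFlats.even_card {r : ℕ} {S : Finset (Fin 32)} (h : EvenOnFlats r S) :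
    Even S.card := by
  cases r with
  | zero => exact h
  | succ r => exact h.1

lemma EvenOnFlats.of_succ {r : ℕ} {S : Finset (Fin 32)} (h : EvenOnFlats (r + 1) S) :
    EvenOnFlats r S := by
  induction r generalizing S with
  | zero => exact h.1
  | succ r ih => exact ⟨h.1, fun m => ih (h.2 m)⟩

lemma EvenOnFlats.sdiff {r : ℕ} {S T : Finset (Fin 32)} (hS : EvenOnFlats r S)
    (hT : EvenOnFlats r T) (hTS : T ⊆ S) : EvenOnFlats r (S \ T) := by
  have hcard : Even (S \ T).card := by
    rw [Finset.card_sdiff_of_subset hTS, Nat.even_sub (Finset.card_le_card hTS)]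
    exact iff_of_true hS.even_card hT.even_card
  induction r generalizing S T with
  | zero => exact hcard
  | succ r ih =>
    refine ⟨hcard, fun m => ?_⟩
    have hsub := Finset.filter_subset_filter (fun i : Fin 32 => i.val.testBit m) hTS
    have h : (S \ T).filter (fun i => i.val.testBit m) =
        S.filter (fun i => i.val.testBit m) \ T.filter (fun i => i.val.testBit m) := by
      ext i
      simp only [Finset.mem_filter, Finset.mem_sdiff]
      tauto
    rw [h]
    refine ih (hS.2 m) (hT.2 m) hsub ?_
    rw [Finset.card_sdiff_of_subset hsub, Nat.even_sub (Finset.card_le_card hsub)]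
    exact iff_of_true (hS.2 m).even_card (hT.2 m).even_card

lemma EvenOnFlats.two_pow_le_card {r : ℕ} {S : Finset (Fin 32)} (h : EvenOnFlats r S)
    (hS : S.Nonempty) : 2 ^ (r + 1) ≤ S.card := by
  induction r generalizing S with
  | zero =>
    obtain ⟨k, hk⟩ := h.even_card
    have := hS.card_pos
    omega
  | succ r ih =>
    obtain ⟨a, ha, b, hb, hab⟩ := Finset.one_lt_card.1 (by
      obtain ⟨k, hk⟩ := h.even_card
      have := hS.card_pos
      omega : 1 < S.card)
    obtain ⟨m, hm⟩ : ∃ m : Fin 5, a.val.testBit m ≠ b.val.testBit m :=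
      (by decide +kernel : ∀ a b : Fin 32, a ≠ b →
        ∃ m : Fin 5, a.val.testBit m ≠ b.val.testBit m) a b hab
    set F := S.filter fun i => i.val.testBit m with hF
    have hFS : F ⊆ S := Finset.filter_subset _ _
    have hF1 : F.Nonempty := by
      by_contra hne
      simp only [hF, Finset.not_nonempty_iff_eq_empty, Finset.filter_eq_empty_iff] at hne
      exact hm (by rw [Bool.eq_false_iff.2 (hne ha), Bool.eq_false_iff.2 (hne hb)])
    have hF2 : (S \ F).Nonempty := by
      rw [Finset.sdiff_nonempty]
      exact fun hle => hm (by
        rw [(Finset.mem_filter.1 (hle ha)).2, (Finset.mem_filter.1 (hle hb)).2])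
    have h1 : _ ≤ F.card := ih (h.2 m) hF1
    have h2 : _ ≤ (S \ F).card := ih (h.of_succ.sdiff (h.2 m) hFS) hF2
    have h3 := Finset.card_sdiff_add_card_eq_card hFS
    rw [pow_succ] at h1 h2 ⊢
    omega

lemma eight_le_hammingWt_of_mem_reedMuller {x : Fin 32 → ZMod 2} (hx : x ∈ reedMuller)
    (hx0 : x ≠ 0) : 8 ≤ hammingWt x := by
  have key : ∀ t, bitDegree t ≤ 2 →
      Even (univ.filter fun i => monomialWord t i * x i ≠ 0).card := fun t ht => by
    have h := hx t ht
    rwa [innerZ, sum_eq_card_ne_zero, ZMod.natCast_eq_zero_iff_even] at h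
  have h0 : Even (univ.filter fun i => x i ≠ 0).card := by
    convert key 0 (by decide +kernel) using 5 with i
    simp [monomialWord]
  have h1 : ∀ m : Fin 5,
      Even ((univ.filter fun i => x i ≠ 0).filter fun i => i.val.testBit m).card := by
    intro m
    obtain ⟨t, ht, hti⟩ := (by decide +kernel : ∀ m : Fin 5, ∃ t, bitDegree t ≤ 2 ∧
      ∀ i : Fin 32, monomialWord t i = if i.val.testBit m then 1 else 0) m
    convert key t ht using 2
    ext i
    simp [hti, and_comm]
  have h2 : ∀ m m' : Fin 5, Even (((univ.filter fun i => x i ≠ 0).filter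
      fun i => i.val.testBit m).filter fun i => i.val.testBit m').card := by
    intro m m'
    obtain ⟨t, ht, hti⟩ := (by decide +kernel : ∀ m m' : Fin 5, ∃ t, bitDegree t ≤ 2 ∧
      ∀ i : Fin 32, monomialWord t i = if i.val.testBit m ∧ i.val.testBit m' then 1 else 0) m m'
    convert key t ht using 2
    ext i
    simp [hti]
    tauto
  refine EvenOnFlats.two_pow_le_card (r := 2) ⟨h0, fun m => ⟨h1 m, h2 m⟩⟩ ?_
  obtain ⟨i, hi⟩ := Function.ne_iff.1 hx0
  exact ⟨i, by simpa using hi⟩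

end ReedMuller

/-! ### The gluing words -/

section Glue

/-- Words of length 32 over `ZMod 8` generating the codes below modulo `twiceCode reedMuller`;
the entries are given by their binary digits. -/
def glueWord : Fin 6 → Fin 32 → ZMod 8 :=
  ![bitVec 8 4294967295,
    bitVec 8 1496318869 + 2 • bitVec 8 369684303 + 4 • bitVec 8 2147483648,
    bitVec 8 297472443 + 2 • bitVec 8 4060740163 + 4 • bitVec 8 1342177280,
    bitVec 8 1431655765 + 2 • bitVec 8 4038252442 + 4 • bitVec 8 67108864,
    bitVec 8 3195911810 + 2 • bitVec 8 1721396319 + 4 • bitVec 8 402653184,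
    bitVec 8 768791085 + 2 • bitVec 8 3191418805 + 4 • bitVec 8 671088640]

/-- All glue words, as a list. -/
def glueWords : List (Fin 32 → ZMod 8) := (List.finRange 6).map glueWord

lemma innerZ_glueWord : ∀ i j, innerZ (glueWord i) (glueWord j) = 0 := by
  decide +kernel

lemma dvd_euclWt_glueWord : ∀ i, 16 ∣ euclWt (glueWord i) := by
  decide +kernel

lemma res2_glueWord_mem : ∀ i, res2 (glueWord i) ∈ reedMuller := by
  have : ∀ i t, bitDegree t ≤ 2 → innerZ (monomialWord t) (res2 (glueWord i)) = 0 := by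
    decide +kernel
  exact this

/-- Lists of words of the Reed–Muller code of order 2, written in binary, such that the words of
each list have no common support. -/
def testWords : List (List ℕ) :=
  [[3342540, 562332705], [3932355, 1761646080], [5898330, 612466980], [6881430, 1006682880],
    [9830505, 3271572480], [10027161, 287445282], [13369548, 1143096354], [51121155, 2282824260],
    [53489667, 2219329668], [106957200, 2282824260], [160469001, 608322084], [286331153,
    1145324612], [286331153, 2852170240], [304161042, 3222015168], [339820820, 2189568040],
    [344080680, 1616941200], [572662306, 2290649224], [574890564, 3422604288], [805503792,
    1216644168], [806141955, 1099043880], [1109661825, 2566940160], [1509972480, 2219319570],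
    [13260, 178259280, 405021720], [27030, 43605, 673726785], [3982080, 679624980, 679641640],
    [10813605, 11141290, 51121155], [11141290, 12779715, 1761607785], [11141290, 1108875330,
    2188519640], [12779580, 94373280, 1210126980], [12794880, 2185303080, 2685050890], [50540592,
    572688520, 2172721176], [62917680, 608338200, 2735123465], [62926860, 84544005, 168430090],
    [89130320, 808501440, 2741021840], [157310985, 2394047105, 3284336640], [164234810, 202113795,
    344080680], [168430090, 3221425200, 3222012720], [294160401, 1099048980, 4026531855],
    [336888450, 675353730, 2516620800], [558400530, 2768282880, 3222024195], [808455180,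
    1717960704, 2223277188], [1115756580, 2014433860, 2852170240]]

lemma bitVec_mem_reedMuller : ∀ T ∈ testWords, ∀ b ∈ T, bitVec 2 b ∈ reedMuller := by
  have : ∀ T ∈ testWords, ∀ b ∈ T, ∀ t, bitDegree t ≤ 2 →
      innerZ (monomialWord t) (bitVec 2 b) = 0 := by
    decide +kernel
  exact this

lemma exists_testBit_eq_false : ∀ T ∈ testWords, ∀ p : Fin 32, ∃ b ∈ T, b.testBit p = false := by
  decide +kernel

/-- Number of odd entries. -/
def oddCount (z : Fin 32 → ZMod 8) : ℕ := (univ.filter fun i => 4 * z i ≠ 0).card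

/-- A sufficient condition for the absence of words of Euclidean weight 16 in a self-dual code
containing `2 • bitVec 8 b` for the test words `b` and having a word congruent to `z` modulo
`twiceCode reedMuller`. -/
def Separated (z : Fin 32 → ZMod 8) : Prop :=
  20 ≤ oddCount z ∨ 12 ≤ oddCount z ∧ ∃ T ∈ testWords, ∀ b ∈ T,
    (∀ i : Fin 32, b.testBit i → 4 * z i = 0) ∧ innerZ z ((2 : ℤ) • bitVec 8 b) ≠ 0

instance (z : Fin 32 → ZMod 8) : Decidable (Separated z) := by
  unfold Separated; infer_instance

lemma separated_sum : ∀ l ∈ glueWords.sublists, l ≠ [] → Separated l.sum := by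
  decide +kernel

end Glue

/-! ### Extremality -/

section Extremal

lemma four_mul_eq_of_res2_eq {n : ℕ} {x z : Fin n → ZMod 8} (h : res2 x = res2 z) (i : Fin n) :
    4 * x i = 4 * z i := by
  have := congrFun h i
  rw [← sub_eq_zero, ← mul_sub, ← castHom_two_eq_zero_iff, map_sub, sub_eq_zero]
  exact this

lemma ne_zero_of_euclWt_ne_zero {n : ℕ} {x : Fin n → ZMod 8} (hx : x ≠ 0) : euclWt x ≠ 0 := by
  intro h
  rw [euclWt_eq_sum, Finset.sum_eq_zero_iff] at h
  exact hx (funext fun i => (by decide : ∀ a : ZMod 8, sqWt a = 0 → a = 0) _ (h i (mem_univ i)))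

lemma thirtyTwo_dvd_euclWt {n : ℕ} {x : Fin n → ZMod 8} (h : ∀ i, 2 * x i = 0)
    (hsum : ∑ i, x i = 0) : 32 ∣ euclWt x := by
  let f : ZMod 8 →+ ZMod 32 := ⟨⟨fun a => ((4 * a.val : ℕ) : ZMod 32), by decide⟩, by decide⟩
  rw [← ZMod.natCast_eq_zero_iff, euclWt_eq_sum, Nat.cast_sum, ← map_zero f, ← hsum, map_sum]
  exact Finset.sum_congr rfl fun i _ =>
    (by decide : ∀ a : ZMod 8, 2 * a = 0 → (sqWt a : ZMod 32) = ((4 * a.val : ℕ) : ZMod 32)) _ (h i)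

/-- Odd entries contribute at least 1, nonzero even entries at least 4 to the Euclidean weight. -/
lemma card_odd_add_four_mul_card_even_le {n : ℕ} (x : Fin n → ZMod 8) :
    (univ.filter fun i => 4 * x i ≠ 0).card +
      4 * (univ.filter fun i => 4 * x i = 0 ∧ x i ≠ 0).card ≤ euclWt x := by
  simp only [Finset.card_filter, Finset.mul_sum, ← Finset.sum_add_distrib, euclWt_eq_sum]
  refine Finset.sum_le_sum fun i _ => ?_
  exact (by decide : ∀ a : ZMod 8, (if 4 * a ≠ 0 then 1 else 0) +
    4 * (if 4 * a = 0 ∧ a ≠ 0 then 1 else 0) ≤ sqWt a) (x i)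

lemma res2_bitVec (m : ℕ) : res2 (bitVec 8 m) = bitVec 2 m := by
  ext1 i
  rw [res2_apply, bitVec, bitVec]
  split_ifs
  · exact map_one _
  · exact map_zero _

lemma euclWt_ne_sixteen_of_separated {x z : Fin 32 → ZMod 8} (hz : Separated z)
    (hxz : x - z ∈ twiceCode reedMuller) : euclWt x ≠ 16 := by
  intro h16
  have hodd : ∀ i, 4 * x i = 4 * z i := four_mul_eq_of_res2_eq (by
    rw [← sub_eq_zero, ← map_sub]
    exact res2_eq_zero_of_mem_twiceCode hxz)
  have hle := card_odd_add_four_mul_card_even_le x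
  have hcount : (univ.filter fun i => 4 * x i ≠ 0).card = oddCount z := by
    simp only [hodd, oddCount]
  rw [hcount, h16] at hle
  rcases hz with hz | ⟨hz, T, hT, h⟩
  · omega
  · have hcard : (univ.filter fun i => 4 * x i = 0 ∧ x i ≠ 0).card ≤ 1 := by omega
    obtain ⟨p, hp⟩ : ∃ p, ∀ i, 4 * x i = 0 → i ≠ p → x i = 0 := by
      rw [Finset.card_le_one_iff_subset_singleton] at hcard
      obtain ⟨p, hp⟩ := hcard
      refine ⟨p, fun i hi hip => by_contra fun hxi => hip ?_⟩
      exact Finset.mem_singleton.1 (hp (by simp [hi, hxi]))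
    obtain ⟨b, hb, hbp⟩ := exists_testBit_eq_false T hT p
    obtain ⟨hdis, hne⟩ := h b hb
    have hmem : (2 : ℤ) • bitVec 8 b ∈ twiceCode reedMuller := two_zsmul_mem_twiceCode (by
      rw [res2_bitVec]
      exact bitVec_mem_reedMuller T hT b hb)
    have h0 := (isSelfDual_reedMuller.twiceCode _).1 hxz _ hmem
    rw [innerZ_sub_left, sub_eq_zero] at h0
    rw [← h0] at hne
    refine hne (Finset.sum_eq_zero fun i _ => ?_)
    rw [Pi.smul_apply, bitVec]
    split_ifs with hi
    · have hip : i ≠ p := by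
        rintro rfl
        rw [hbp] at hi
        exact Bool.false_ne_true hi
      rw [hp i ((hodd i).trans (hdis i hi)) hip, zero_mul]
    · rw [smul_zero, mul_zero]

lemma euclWt_ne_sixteen_of_mem_twiceCode {x : Fin 32 → ZMod 8} (hx : x ∈ twiceCode reedMuller)
    (hsum : ∑ i, x i = 0) : euclWt x ≠ 16 := by
  obtain ⟨y, hy, rfl⟩ := mem_twiceCode.1 hx
  intro h16
  by_cases h0 : res2 y = 0
  · have := thirtyTwo_dvd_euclWt (x := (2 : ℤ) • y) (fun i => by
      have := (castHom_two_eq_zero_iff _).1 (congrFun h0 i)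
      rw [Pi.smul_apply, zsmul_eq_mul, ← mul_assoc]
      norm_num
      exact this) hsum
    omega
  · have h1 := eight_le_hammingWt_of_mem_reedMuller hy h0
    have h2 := four_mul_hammingWt_le y
    omega

lemma glueWord_zero : glueWord 0 = 1 := by
  decide +kernel

variable {L : List (Fin 32 → ZMod 8)}

lemma innerZ_of_sublist_glueWords (hL : L.Sublist glueWords) :
    ∀ u ∈ L, ∀ v ∈ L, innerZ u v = 0 := by
  intro u hu v hv
  obtain ⟨i, -, rfl⟩ := List.mem_map.1 (hL.subset hu)
  obtain ⟨j, -, rfl⟩ := List.mem_map.1 (hL.subset hv)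
  exact innerZ_glueWord i j

lemma pairwise_innerZ_of_sublist_glueWords (hL : L.Sublist glueWords) :
    L.Pairwise fun u v => innerZ u v = 0 :=
  List.pairwise_of_forall_mem_list (innerZ_of_sublist_glueWords hL)

lemma res2_mem_of_sublist_glueWords (hL : L.Sublist glueWords) : ∀ u ∈ L, res2 u ∈ reedMuller := by
  intro u hu
  obtain ⟨i, -, rfl⟩ := List.mem_map.1 (hL.subset hu)
  exact res2_glueWord_mem i

lemma isSelfDual_chainCode_reedMuller (hL : L.Sublist glueWords) :
    IsSelfDual (chainCode reedMuller L) :=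
  isSelfDual_chainCode isSelfDual_reedMuller fun u hu => innerZ_of_sublist_glueWords hL u hu u hu

lemma dvd_euclWt_chainCode_reedMuller (hL : L.Sublist glueWords) :
    ∀ x ∈ chainCode reedMuller L, 16 ∣ euclWt x := by
  refine dvd_euclWt_chainCode isSelfDual_reedMuller
    (fun b => four_dvd_hammingWt_of_mem_reedMuller)
    (fun u hu => innerZ_of_sublist_glueWords hL u hu u hu) fun u hu => ?_
  obtain ⟨i, -, rfl⟩ := List.mem_map.1 (hL.subset hu)
  exact dvd_euclWt_glueWord i

lemma minEuclWtIs_chainCode_reedMuller (hL : L.Sublist glueWords) (h0 : glueWord 0 ∈ L) :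
    minEuclWtIs (chainCode reedMuller L) 32 := by
  have hmem : glueWord 0 ∈ chainCode reedMuller L :=
    mem_chainCode_of_mem (pairwise_innerZ_of_sublist_glueWords hL) h0
  refine ⟨fun x hx hx0 => ?_, glueWord 0, hmem, by decide +kernel, by decide +kernel⟩
  have h16 : euclWt x ≠ 16 := by
    obtain ⟨l, hl, hxl⟩ := exists_sublist_of_mem_chainCode (res2_mem_of_sublist_glueWords hL) hx
    rcases eq_or_ne l [] with rfl | hne
    · rw [List.sum_nil, sub_zero] at hxl
      refine euclWt_ne_sixteen_of_mem_twiceCode hxl ?_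
      have := (isSelfDual_chainCode_reedMuller hL x).1 hx _ hmem
      simpa [glueWord_zero, innerZ] using this
    · exact euclWt_ne_sixteen_of_separated
        (separated_sum l (List.mem_sublists.2 (hl.trans hL)) hne) hxl
  have h1 := dvd_euclWt_chainCode_reedMuller hL x hx
  have h2 := ne_zero_of_euclWt_ne_zero hx0
  omega

end Extremal

/-! ### Sixteen codes -/

section Sixteen

/-- The glue words whose indices are the positions of ones in the binary expansion of `m`. -/
def glueSublist (m : ℕ) : List (Fin 32 → ZMod 8) :=
  ((List.finRange 6).filter fun i : Fin 6 => m.testBit i).map glueWord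

lemma glueSublist_sublist (m : ℕ) : (glueSublist m).Sublist glueWords :=
  List.filter_sublist.map glueWord

/-- The sets of glue words used for the sixteen codes, in binary. -/
def glueMask : Fin 16 → ℕ := ![1, 5, 3, 13, 35, 7, 19, 45, 43, 39, 15, 51, 23, 47, 61, 31]

lemma glueWord_zero_mem : ∀ j, glueWord 0 ∈ glueSublist (glueMask j) := by
  have : ∀ j, (glueMask j).testBit 0 := by decide
  exact fun j => List.mem_map_of_mem (List.mem_filter.2 ⟨List.mem_finRange 0, this j⟩)

/-- Numbers of residue words of weights 12 and 16 in the sixteen codes. -/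
def residueTable : Fin 16 → ℕ × ℕ := fun j =>
  (![0, 0, 1, 0, 1, 2, 3, 0, 2, 3, 4, 5, 6, 6, 8, 12] j,
    ![0, 2, 0, 6, 4, 2, 0, 14, 10, 8, 6, 4, 2, 18, 14, 6] j)

lemma residueTable_injective : Function.Injective residueTable := by
  decide +kernel

lemma residueCount_glueSublist (j : Fin 16) :
    (residueCount (chainCode reedMuller (glueSublist (glueMask j))) 12,
      residueCount (chainCode reedMuller (glueSublist (glueMask j))) 16) = residueTable j := by
  have hL := glueSublist_sublist (glueMask j)
  rw [residueCount_chainCode (pairwise_innerZ_of_sublist_glueWords hL)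
    (res2_mem_of_sublist_glueWords hL), residueCount_chainCode
    (pairwise_innerZ_of_sublist_glueWords hL) (res2_mem_of_sublist_glueWords hL)]
  clear hL
  revert j
  decide +kernel

end Sixteen

/-- there are sixteen pairwise inequivalent extremal Type II
`Z₈`-codes of length `32`. -/
theorem sixteen_codes :
    ∃ Cs : Fin 16 → AddSubgroup (Fin 32 → ZMod 8),
      (∀ j, IsSelfDual (Cs j) ∧ (∀ x ∈ Cs j, 16 ∣ euclWt x) ∧
        minEuclWtIs (Cs j) 32) ∧
      ∀ j l, j ≠ l → ¬ codeEquiv (Cs j) (Cs l) := by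
  refine ⟨fun j => chainCode reedMuller (glueSublist (glueMask j)), fun j => ?_,
    fun j l hjl h => ?_⟩
  · have hL := glueSublist_sublist (glueMask j)
    exact ⟨isSelfDual_chainCode_reedMuller hL, dvd_euclWt_chainCode_reedMuller hL,
      minEuclWtIs_chainCode_reedMuller hL (glueWord_zero_mem j)⟩
  · refine hjl (residueTable_injective ?_)
    rw [← residueCount_glueSublist, ← residueCount_glueSublist, residueCount_eq_of_codeEquiv h,
      residueCount_eq_of_codeEquiv h]
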